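/- arXiv:1210.1311 — 2 statements merged into one kernel-verified Lean document; each statement's English description precedes it below -/
import Mathlib

section
/- Let (X, T) be the minimal non-periodic S-adic subshift defined by a sequence (σ_n : A_n* → A_{n-1}*, a_n ∈ A_n)_{n≥2} of proper morphisms such that each σ_n extends by concatenation to a one-to-one map from X_n into X_{n-1}, and set τ_n = σ_2 ∘ ⋯ ∘ σ_n. Then the sequence of partitions P(n) = { T^j τ_n([c]_{X_{n+1}}) : c ∈ A_n, 0 ≤ j < |τ_n(c)| } generates the topology of X: for any two distinct points x, y ∈ X there exist n ≥ 2, c ∈ A_n and 0 ≤ j < |τ_n(c)| such that x ∈ T^j τ_n([c]_{X_{n+1}}) and y ∉ T^j τ_n([c]_{X_{n+1}}). -/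
/-- The extension of a morphism (given by its values on letters) to words, acting by
concatenation. -/
def wordApply {A B : Type*} (σ : A → List B) (w : List A) : List B :=
  (w.map σ).flatten

/-- The factor `x_i x_{i+1} ⋯ x_{i+m-1}` of a biinfinite sequence `x`. -/
def seg {A : Type*} (x : ℤ → A) (i : ℤ) (m : ℕ) : List A :=
  (List.range m).map fun k => x (i + k)

/-- The shift by `p` on biinfinite sequences; `shiftBy 1` is the shift map `T`. -/
def shiftBy {A : Type*} (p : ℤ) (x : ℤ → A) : ℤ → A :=
  fun i => x (i + p)

/-- A morphism is proper if all its images begin with a common letter `l` and end with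
a common letter `r`. -/
def ProperMorphism {B C : Type*} (σ : B → List C) : Prop :=
  ∃ l r : C, ∀ x : B, (σ x).head? = some l ∧ (σ x).getLast? = some r

/-- Given a directive sequence of morphisms `σ n : A (n+1)* → A n*`, the composition
`σ 0 ∘ σ 1 ∘ ⋯ ∘ σ (k-1)` applied to a letter of `A k`. -/
def down {A : ℕ → Type*} (σ : ∀ n, A (n + 1) → List (A n)) : ∀ k, A k → List (A 0)
  | 0, c => [c]
  | k + 1, c => ((σ k c).map (down σ k)).flatten

/-- The subshift `X n ⊆ (A n)^ℤ` generated by the directive sequence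
`(σ m, a m)_{m ≥ n}` : the set of sequences all of whose finite factors occur in some
word `σ n ∘ σ (n+1) ∘ ⋯ ∘ σ (n+k-1) (a (n+k))`. -/
def XX {A : ℕ → Type*} (σ : ∀ n, A (n + 1) → List (A n)) (a : ∀ n, A n) (n : ℕ) :
    Set (ℤ → A n) :=
  { x | ∀ (i : ℤ) (m : ℕ), ∃ k : ℕ,
      seg x i m <:+: down (A := fun j => A (n + j)) (fun j => σ (n + j)) k (a (n + k)) }

/-- Cumulative length function: `cum f k` is the (signed) sum of `f` over the interval
between `0` and `k`. -/
def cum (f : ℤ → ℕ) : ℤ → ℤ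
  | Int.ofNat n => ∑ i ∈ Finset.range n, (f i : ℤ)
  | Int.negSucc n => -∑ i ∈ Finset.range (n + 1), (f (Int.negSucc i) : ℤ)

/-- `ExtSeq σ y z` expresses that `z` is the image of the biinfinite sequence `y`
under the concatenation extension of the morphism `σ`, i.e.
`z = ⋯ σ(y_{-1}) . σ(y_0) σ(y_1) ⋯` with `σ(y_0)` starting at coordinate `0`. -/
def ExtSeq {B C : Type*} (σ : B → List C) (y : ℤ → B) (z : ℤ → C) : Prop :=
  ∀ k : ℤ, seg z (cum (fun j => (σ (y j)).length) k) (σ (y k)).length = σ (y k)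

/-- The atom `T^j τ_k([c]_{X (k)})` of the partition `P`, where
`τ_k = σ 0 ∘ ⋯ ∘ σ (k-1)` : the set of points of the form `T^j τ_k(y)` with
`y ∈ X k` and `y 0 = c`. -/
def Atom {A : ℕ → Type*} (σ : ∀ n, A (n + 1) → List (A n)) (a : ∀ n, A n)
    (k : ℕ) (c : A k) (j : ℕ) : Set (ℤ → A 0) :=
  { x | ∃ (y : ℤ → A k) (z : ℤ → A 0), y ∈ XX σ a k ∧ y 0 = c ∧
      ExtSeq (down σ k) y z ∧ x = shiftBy (j : ℤ) z }

open Filter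

section Words

variable {B C D : Type*}

theorem wordApply_nil (f : B → List C) : wordApply f [] = [] := rfl

theorem wordApply_cons (f : B → List C) (b : B) (w : List B) :
    wordApply f (b :: w) = f b ++ wordApply f w := by
  simp [wordApply]

theorem wordApply_singleton (f : B → List C) (b : B) : wordApply f [b] = f b := by
  simp [wordApply]

theorem wordApply_append (f : B → List C) (v w : List B) :
    wordApply f (v ++ w) = wordApply f v ++ wordApply f w := by
  simp [wordApply]

theorem wordApply_wordApply (f : C → List D) (g : B → List C) (w : List B) :
    wordApply f (wordApply g w) = wordApply (fun b => wordApply f (g b)) w := by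
  induction w with
  | nil => rfl
  | cons b w ih => rw [wordApply_cons, wordApply_append, ih, wordApply_cons]

theorem wordApply_isInfix (f : B → List C) {v w : List B} (h : v <:+: w) :
    wordApply f v <:+: wordApply f w := by
  obtain ⟨s, t, rfl⟩ := h
  exact ⟨wordApply f s, wordApply f t, by simp only [wordApply_append]⟩

theorem length_wordApply_le {f : B → List C} {L : ℕ} (hf : ∀ b, (f b).length ≤ L)
    (w : List B) : (wordApply f w).length ≤ L * w.length := by
  induction w with
  | nil => simp [wordApply]
  | cons b w ih =>
    rw [wordApply_cons, List.length_append, List.length_cons]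
    linarith [hf b]

theorem length_le_length_wordApply {f : B → List C} (hf : ∀ b, 0 < (f b).length)
    (w : List B) : w.length ≤ (wordApply f w).length := by
  induction w with
  | nil => simp
  | cons b w ih =>
    rw [wordApply_cons, List.length_append, List.length_cons]
    linarith [hf b]

theorem exists_length_le [Finite B] (f : B → List C) : ∃ L, ∀ b, (f b).length ≤ L := by
  obtain ⟨L, hL⟩ := (Set.finite_range fun b => (f b).length).bddAbove
  exact ⟨L, fun b => hL ⟨b, rfl⟩⟩

end Words

section Segments

variable {B C : Type*}

theorem seg_eq_map (x : ℤ → B) (i : ℤ) (m : ℕ) :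
    seg x i m = (List.range m).map fun s : ℕ => x (i + s) := by
  simp [seg, List.map_flatMap]
  exact List.map_eq_flatMap.symm

theorem length_seg (x : ℤ → B) (i : ℤ) (m : ℕ) : (seg x i m).length = m := by
  simp [seg_eq_map]

theorem getElem?_seg (x : ℤ → B) (i : ℤ) {m s : ℕ} (h : s < m) :
    (seg x i m)[s]? = some (x (i + s)) := by
  simp [seg_eq_map, h]

theorem seg_eq_of_getElem? {x : ℤ → B} {i : ℤ} {l : List B}
    (h : ∀ s < l.length, l[s]? = some (x (i + s))) : seg x i l.length = l := by
  apply List.ext_getElem?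
  intro s
  by_cases hs : s < l.length
  · rw [getElem?_seg _ _ hs, h s hs]
  · rw [List.getElem?_eq_none (by rw [length_seg]; omega), List.getElem?_eq_none (by omega)]

theorem getElem?_eq_of_seg_eq {x : ℤ → B} {i : ℤ} {l : List B}
    (h : seg x i l.length = l) {s : ℕ} (hs : s < l.length) : l[s]? = some (x (i + s)) := by
  rw [← getElem?_seg x i hs, h]

theorem exists_offset_of_infix_seg {x : ℤ → B} {i : ℤ} {m : ℕ} {w : List B}
    (h : seg x i m <:+: w) :
    ∃ p, p + m ≤ w.length ∧ ∀ s < m, w[p + s]? = some (x (i + s)) := by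
  obtain ⟨u, v, rfl⟩ := h
  refine ⟨u.length, by simp [length_seg], fun s hs => ?_⟩
  rw [List.append_assoc, List.getElem?_append_right (by omega), Nat.add_sub_cancel_left,
    List.getElem?_append_left (by rwa [length_seg]), getElem?_seg _ _ hs]

theorem seg_infix_of_offset {x : ℤ → B} {i : ℤ} {m p : ℕ} {w : List B}
    (hp : p + m ≤ w.length) (h : ∀ s < m, w[p + s]? = some (x (i + s))) :
    seg x i m <:+: w := by
  have hl : ((w.drop p).take m).length = m := by simp; omega
  have : seg x i m = (w.drop p).take m := by
    conv_lhs => rw [← hl]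
    apply seg_eq_of_getElem?
    intro s hs
    rw [hl] at hs
    rw [List.getElem?_take_of_lt hs, List.getElem?_drop, h s hs]
  rw [this]
  exact (List.take_prefix _ _).isInfix.trans (List.drop_suffix _ _).isInfix

theorem seg_shiftBy (x : ℤ → B) (p i : ℤ) (m : ℕ) :
    seg (shiftBy p x) i m = seg x (i + p) m := by
  simp [seg_eq_map, shiftBy, add_right_comm]

theorem seg_congr {x y : ℤ → B} {i : ℤ} {m : ℕ}
    (h : ∀ s < m, x (i + (s : ℕ)) = y (i + (s : ℕ))) : seg x i m = seg y i m := by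
  simp only [seg_eq_map]
  apply List.map_congr_left
  intro s hs
  exact h s (List.mem_range.1 hs)

theorem seg_infix_seg (x : ℤ → B) {i i' : ℤ} {m m' : ℕ} (h : i' ≤ i)
    (h' : i + m ≤ i' + m') : seg x i m <:+: seg x i' m' := by
  obtain ⟨p, hp⟩ := Int.eq_ofNat_of_zero_le (sub_nonneg.2 h)
  refine seg_infix_of_offset (p := p) (by rw [length_seg]; omega) fun s hs => ?_
  rw [getElem?_seg _ _ (by omega)]
  congr 2
  push_cast
  omega

end Segments

section Cum

theorem cum_zero (f : ℤ → ℕ) : cum f 0 = 0 := by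
  change cum f (Int.ofNat 0) = 0
  simp [cum]

theorem cum_succ (f : ℤ → ℕ) (t : ℤ) : cum f (t + 1) = cum f t + f t := by
  rcases t with n | n
  · change cum f (Int.ofNat (n + 1)) = cum f (Int.ofNat n) + _
    simp [cum, Finset.sum_range_succ]
  · rcases n with _ | n
    · change cum f (Int.ofNat 0) = _
      simp [cum]
    · change cum f (Int.negSucc n) = _
      simp only [cum]
      rw [Finset.sum_range_succ _ (n + 1)]
      ring

theorem cum_add (f : ℤ → ℕ) (i t : ℤ) :
    cum f (i + t) = cum f i + cum (fun s => f (i + s)) t := by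
  induction t using Int.induction_on with
  | zero => simp [cum_zero]
  | succ n ih => rw [← add_assoc, cum_succ, ih, cum_succ, add_assoc]
  | pred n ih =>
    have h₁ := cum_succ f (i + (-n - 1))
    have h₂ := cum_succ (fun s => f (i + s)) (-n - 1)
    rw [show i + (-(n : ℤ) - 1) + 1 = i + -n by ring] at h₁
    rw [sub_add_cancel] at h₂
    linarith

theorem cum_add_le {f : ℤ → ℕ} {L : ℕ} (hf : ∀ t, f t ≤ L) (i : ℤ) (n : ℕ) :
    cum f (i + n) ≤ cum f i + L * n := by
  induction n with
  | zero => simp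
  | succ n ih =>
    rw [Nat.cast_succ, ← add_assoc, cum_succ]
    have : (f (i + n) : ℤ) ≤ L := by exact_mod_cast hf _
    linarith

theorem strictMono_cum {f : ℤ → ℕ} (hf : ∀ t, 0 < f t) : StrictMono (cum f) :=
  strictMono_int_of_lt_succ fun t => by
    rw [cum_succ]
    have : (0 : ℤ) < f t := by exact_mod_cast hf t
    linarith

theorem exists_cum_le_lt {f : ℤ → ℕ} (hf : ∀ t, 0 < f t) (q : ℕ) :
    ∃ i : ℕ, cum f i ≤ q ∧ (q : ℤ) < cum f (i + 1) := by
  have hlb : ∀ n : ℕ, (n : ℤ) ≤ cum f n := by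
    intro n
    induction n with
    | zero => simp [cum_zero]
    | succ n ih =>
      rw [Nat.cast_succ, cum_succ]
      have : (0 : ℤ) < f n := by exact_mod_cast hf n
      linarith
  classical
  have hex : ∃ i : ℕ, (q : ℤ) < cum f (i + 1) := ⟨q, by
    have := hlb (q + 1)
    push_cast at this
    linarith⟩
  refine ⟨Nat.find hex, ?_, Nat.find_spec hex⟩
  rcases h : Nat.find hex with _ | i
  · simp [cum_zero]
  · have := Nat.find_min hex (m := i) (by omega)
    push_cast
    exact not_lt.1 this

theorem eventually_cum_eq {ι : Type*} {l : Filter ι} {F : ι → ℤ → ℕ} {f : ℤ → ℕ}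
    (h : ∀ t, ∀ᶠ N in l, F N t = f t) (t : ℤ) : ∀ᶠ N in l, cum (F N) t = cum f t := by
  induction t using Int.induction_on with
  | zero => simp [cum_zero]
  | succ n ih =>
    filter_upwards [ih, h n] with N h₁ h₂
    rw [cum_succ, cum_succ, h₁, h₂]
  | pred n ih =>
    filter_upwards [ih, h (-n - 1)] with N h₁ h₂
    have e₁ := cum_succ (F N) (-n - 1)
    have e₂ := cum_succ f (-n - 1)
    rw [sub_add_cancel] at e₁ e₂
    rw [h₂] at e₁
    linarith

end Cum

section Desubstitution

variable {B C : Type*}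

theorem Ultrafilter.exists_eventually_eq {ι : Type*} (U : Ultrafilter ι) [Finite B]
    (g : ι → B) : ∃ b, ∀ᶠ i in U, g i = b := by
  by_contra! h
  have h' : ∀ b, ∀ᶠ i in U, g i ≠ b := fun b =>
    h b
  obtain ⟨i, hi⟩ := (eventually_all.2 h').exists
  exact hi _ rfl

theorem length_wordApply_take {f : B → List C} {u : List B} {g : ℤ → B}
    (hg : ∀ t < u.length, u[t]? = some (g (t : ℕ))) {n : ℕ} (hn : n ≤ u.length) :
    ((wordApply f (u.take n)).length : ℤ) = cum (fun j => (f (g j)).length) n := by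
  induction n with
  | zero => simp [wordApply_nil, cum_zero]
  | succ n ih =>
    rw [List.take_add_one, wordApply_append, hg n hn, Option.toList_some,
      wordApply_singleton, List.length_append, Nat.cast_add, ih (by omega), Nat.cast_succ,
      cum_succ]

theorem getElem?_wordApply {f : B → List C} {u : List B} {g : ℤ → B}
    (hg : ∀ t < u.length, u[t]? = some (g (t : ℕ))) {t : ℕ} (ht : t < u.length) {s : ℕ}
    (hs : s < (f (g t)).length) {p : ℕ}
    (hp : (p : ℤ) = cum (fun j => (f (g j)).length) t + s) :
    (wordApply f u)[p]? = (f (g t))[s]? := by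
  have hu : u = u.take t ++ (g t :: u.drop (t + 1)) := by
    have h₁ := List.getElem?_eq_getElem ht
    rw [hg t ht, Option.some_inj] at h₁
    rw [h₁, ← List.drop_eq_getElem_cons ht, List.take_append_drop]
  have := length_wordApply_take (f := f) hg ht.le
  have hp' : p = (wordApply f (u.take t)).length + s := by omega
  rw [hu, wordApply_append, wordApply_cons, List.getElem?_append_right (by omega),
    List.getElem?_append_left (by omega), hp', Nat.add_sub_cancel_left]

/-- A long factor of an image can be desubstituted on a window around the origin. -/
theorem exists_window_desubstitution {f : B → List C} {L : ℕ} [Nonempty B]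
    (hf : ∀ b, 0 < (f b).length) (hL : ∀ b, (f b).length ≤ L) {P : List B → Prop}
    (hP : ∀ v w, v <:+: w → P w → P v) {x : ℤ → C}
    (hx : ∀ i m, ∃ u, P u ∧ seg x i m <:+: wordApply f u) (N : ℕ) :
    ∃ (y : ℤ → B) (j : Fin L), P (seg y (-N) (2 * N + 1)) ∧ (j : ℕ) < (f (y 0)).length ∧
      ∀ t : ℤ, -N ≤ t → t ≤ N →
        seg x (cum (fun s => (f (y s)).length) t - j) (f (y t)).length = f (y t) := by
  set M : ℕ := (N + 2) * L with hM
  obtain ⟨u, hPu, hu⟩ := hx (-M) (2 * M)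
  obtain ⟨p, hp, hpx⟩ := exists_offset_of_infix_seg hu
  obtain ⟨g, hg⟩ : ∃ g : ℤ → B, ∀ t < u.length, u[t]? = some (g (t : ℕ)) :=
    ⟨fun t => u.getD t.toNat (Classical.arbitrary B), fun t ht => by simp [ht]⟩
  set F : ℤ → ℕ := fun j => (f (g j)).length with hF
  have hFpos : ∀ t, 0 < F t := fun t => hf _
  have hFL : ∀ t, F t ≤ L := fun t => hL _
  have hmono := strictMono_cum hFpos
  have hlen : ((wordApply f u).length : ℤ) = cum F u.length := by
    simpa using length_wordApply_take (f := f) hg le_rfl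
  obtain ⟨i, hi, hi'⟩ := exists_cum_le_lt hFpos (p + M)
  have hi₁ := cum_succ F i
  have hFi : (F i : ℤ) ≤ L := by exact_mod_cast hFL i
  have hLpos : (0 : ℤ) < L := lt_of_lt_of_le (by exact_mod_cast hFpos i) hFi
  have hMz : (M : ℤ) = N * L + 2 * L := by rw [hM]; push_cast; ring
  have hup := cum_add_le hFL i N
  have hlow := cum_add_le hFL (i - N) N
  rw [sub_add_cancel] at hlow
  have hpM : (p : ℤ) + 2 * M ≤ cum F u.length := by rw [← hlen]; exact_mod_cast hp
  push_cast at hi hi'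
  have hright : (i : ℤ) + N < u.length := hmono.lt_iff_lt.1 (by nlinarith)
  have hleft : (0 : ℤ) ≤ i - N := hmono.le_iff_le.1 (by rw [cum_zero]; nlinarith)
  obtain ⟨j, hj⟩ := Int.eq_ofNat_of_zero_le (sub_nonneg.2 hi)
  have hjF : j < F i := by omega
  have hshift : ∀ t, cum (fun s => (f (g (i + s))).length) t = cum F (i + t) - cum F i :=
    fun t => by rw [cum_add F i t]; simp [hF]
  refine ⟨fun t => g (i + t), ⟨j, hjF.trans_le (hFL _)⟩, ?_, by simpa using hjF, ?_⟩
  · refine hP _ u (seg_infix_of_offset (p := i - N) (by omega) fun s hs => ?_) hPu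
    rw [hg _ (by omega)]
    congr 2
    omega
  · intro t ht ht'
    obtain ⟨n, hn⟩ := Int.eq_ofNat_of_zero_le (show 0 ≤ i + t by omega)
    apply seg_eq_of_getElem?
    intro s hs
    have hsF : (s : ℤ) < F (i + t) := by exact_mod_cast hs
    have h₁ : cum F (i - N) ≤ cum F (i + t) := hmono.monotone (by omega)
    have h₂ : cum F (i + t) ≤ cum F (i + N) := hmono.monotone (by omega)
    have h₃ : (F (i + t) : ℤ) ≤ L := by exact_mod_cast hFL _
    have hr₁ : (p : ℤ) ≤ cum F (i + t) + s := by nlinarith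
    have hr₂ : cum F (i + t) + s < p + 2 * M := by nlinarith
    obtain ⟨r, hr⟩ := Int.eq_ofNat_of_zero_le (sub_nonneg.2 hr₁)
    have hW := hpx r (by omega)
    simp only [hn] at hs hr ⊢
    rw [getElem?_wordApply hg (t := n) (by omega) hs (by rw [← hF]; push_cast; omega)] at hW
    rw [hW]
    congr 2
    have := hshift t
    rw [hn] at this
    rw [this]
    omega

/-- If all factors of `x` are factors of images of words in a factor-closed language, then
`x` is a shift of the image of a sequence all of whose factors lie in the language. -/
theorem exists_desubstitution {f : B → List C} [Finite B] [Nonempty B]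
    (hf : ∀ b, 0 < (f b).length) {P : List B → Prop}
    (hP : ∀ v w, v <:+: w → P w → P v) {x : ℤ → C}
    (hx : ∀ i m, ∃ u, P u ∧ seg x i m <:+: wordApply f u) :
    ∃ (y : ℤ → B) (j : ℕ), (∀ i m, P (seg y i m)) ∧ j < (f (y 0)).length ∧
      ExtSeq f y (shiftBy (-j) x) := by
  obtain ⟨L, hL⟩ := exists_length_le f
  choose Y J hYP hJ hY using exists_window_desubstitution hf hL hP hx
  choose y hy using fun t : ℤ => (hyperfilter ℕ).exists_eventually_eq fun N => Y N t
  obtain ⟨j, hj⟩ := (hyperfilter ℕ).exists_eventually_eq J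
  have hlarge : ∀ n : ℕ, ∀ᶠ N in (hyperfilter ℕ : Filter ℕ), n ≤ N := fun n =>
    Nat.hyperfilter_le_atTop (eventually_ge_atTop n)
  refine ⟨y, j, fun i m => ?_, ?_, fun t => ?_⟩
  · have hwin : ∀ᶠ N in (hyperfilter ℕ : Filter ℕ), ∀ s : Fin m,
        Y N (i + (s : ℕ)) = y (i + (s : ℕ)) := eventually_all.2 fun s => hy _
    obtain ⟨N, hN, hN'⟩ := (hwin.and (hlarge (i.natAbs + m))).exists
    rw [← seg_congr fun s hs => hN ⟨s, hs⟩]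
    exact hP _ _ (seg_infix_seg _ (by omega) (by push_cast; omega)) (hYP N)
  · obtain ⟨N, hN, hN'⟩ := ((hy 0).and hj).exists
    rw [← hN, ← hN']
    exact hJ N
  · have hcum := eventually_cum_eq (f := fun s => (f (y s)).length)
      (F := fun N s => (f (Y N s)).length)
      (fun s => (hy s).mono fun N hN => by rw [hN]) t
    obtain ⟨N, ⟨⟨h₁, h₂⟩, h₃⟩, h₄⟩ :=
      (((hcum.and (hy t)).and hj).and (hlarge t.natAbs)).exists
    have := hY N t (by omega) (by omega)
    rw [h₁, h₂, h₃] at this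
    rw [seg_shiftBy, ← sub_eq_add_neg]
    exact this

end Desubstitution

section Sadic

variable {A : ℕ → Type*} {σ : ∀ n, A (n + 1) → List (A n)} {a : ∀ n, A n}

theorem down_succ (σ : ∀ n, A (n + 1) → List (A n)) (k : ℕ)
    (c : A (k + 1)) : down σ (k + 1) c = wordApply (down σ k) (σ k c) := rfl

theorem wordApply_down_zero (σ : ∀ n, A (n + 1) → List (A n)) (w : List (A 0)) :
    wordApply (down σ 0) w = w := by
  induction w with
  | nil => rfl
  | cons b w ih => rw [wordApply_cons, ih]; rfl

theorem wordApply_down_succ (σ : ∀ n, A (n + 1) → List (A n)) (k : ℕ)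
    (w : List (A (k + 1))) :
    wordApply (down σ (k + 1)) w = wordApply (down σ k) (wordApply (σ k) w) := by
  rw [wordApply_wordApply]
  rfl

theorem wordApply_cast (σ : ∀ n, A (n + 1) → List (A n)) {p q : ℕ} (h : p = q)
    (w : List (A (p + 1))) :
    wordApply (σ q) (h ▸ w) = h ▸ wordApply (σ p) w := by
  subst h
  rfl

theorem wordApply_wordApply_down_succ (σ : ∀ n, A (n + 1) → List (A n)) (n k : ℕ)
    (h : n + 1 + k = n + (k + 1)) (w : List (A (n + 1 + k))) :
    wordApply (σ n) (wordApply
        (down (A := fun j => A (n + 1 + j)) (fun j => σ (n + 1 + j)) k) w) =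
      wordApply (down (A := fun j => A (n + j)) (fun j => σ (n + j)) (k + 1))
        (h ▸ w : List (A (n + (k + 1)))) := by
  induction k with
  | zero =>
    rw [wordApply_down_succ, wordApply_down_zero, wordApply_down_zero]
    rfl
  | succ k ih =>
    have h' : n + 1 + k = n + (k + 1) := by omega
    rw [wordApply_down_succ]
    refine (ih h' _).trans ?_
    rw [wordApply_down_succ _ (k + 1)]
    congr 1
    rw [← wordApply_cast σ h' w]
    congr 1
    apply eq_of_heq
    rw [eqRec_heq_iff, heq_eqRec_iff]

/-- The language at level `n` of a directive sequence: the factors of the words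
`σ n ∘ ⋯ ∘ σ (m - 1) (a m)`. -/
inductive Factor (σ : ∀ n, A (n + 1) → List (A n)) (a : ∀ n, A n) :
    ∀ n, List (A n) → Prop
  | letter (n : ℕ) : Factor σ a n [a n]
  | sub {n : ℕ} {v w : List (A n)} : v <:+: w → Factor σ a n w → Factor σ a n v
  | image {n : ℕ} {w : List (A (n + 1))} :
      Factor σ a (n + 1) w → Factor σ a n (wordApply (σ n) w)

theorem Factor.wordApply_down {k : ℕ} {w : List (A k)} (h : Factor σ a k w) :
    Factor σ a 0 (wordApply (down σ k) w) := by
  induction k with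
  | zero => rwa [wordApply_down_zero]
  | succ k ih => rw [wordApply_down_succ]; exact ih h.image

theorem Factor.wordApply_down_shifted {n k : ℕ} {w : List (A (n + k))}
    (h : Factor σ a (n + k) w) :
    Factor σ a n
      (wordApply (down (A := fun j => A (n + j)) (fun j => σ (n + j)) k) w) := by
  induction k with
  | zero => rw [wordApply_down_zero]; exact h
  | succ k ih => rw [wordApply_down_succ]; exact ih h.image

theorem factor_iff {n : ℕ} {v : List (A n)} :
    Factor σ a n v ↔ ∃ k, v <:+:
      down (A := fun j => A (n + j)) (fun j => σ (n + j)) k (a (n + k)) := by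
  constructor
  · intro h
    induction h with
    | letter n => exact ⟨0, List.infix_rfl⟩
    | sub hvw _ ih =>
      obtain ⟨k, hk⟩ := ih
      exact ⟨k, hvw.trans hk⟩
    | @image n w _ ih =>
      obtain ⟨k, hk⟩ := ih
      refine ⟨k + 1, (wordApply_isInfix (σ n) hk).trans ?_⟩
      have h : n + 1 + k = n + (k + 1) := by omega
      have hcast : ∀ {p q : ℕ} (h : p = q), (h ▸ [a p] : List (A q)) = [a q] := by
        rintro p _ rfl
        rfl
      have := wordApply_wordApply_down_succ σ n k h [a (n + 1 + k)]
      rw [wordApply_singleton, hcast h] at this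
      rw [this]
      exact (wordApply_singleton _ _).symm ▸ List.infix_rfl
  · rintro ⟨k, hk⟩
    refine .sub hk ?_
    have := Factor.wordApply_down_shifted (Factor.letter (σ := σ) (a := a) (n + k))
    rwa [wordApply_singleton] at this

theorem mem_XX_iff {n : ℕ} {x : ℤ → A n} :
    x ∈ XX σ a n ↔ ∀ i m, Factor σ a n (seg x i m) := by
  simp only [factor_iff]
  rfl

theorem Factor.exists_image {n : ℕ} {v : List (A n)} (h : Factor σ a n v)
    (hv : 1 < v.length) : ∃ u, Factor σ a (n + 1) u ∧ v <:+: wordApply (σ n) u := by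
  induction h with
  | letter n => simp at hv
  | sub hvw _ ih =>
    obtain ⟨u, hu, hwu⟩ := ih (hv.trans_le hvw.length_le)
    exact ⟨u, hu, hvw.trans hwu⟩
  | image h _ => exact ⟨_, h, List.infix_rfl⟩

theorem Factor.exists_image_down [∀ n, Finite (A n)] (k : ℕ) :
    ∃ L, ∀ v, Factor σ a 0 v → L < v.length →
      ∃ u, Factor σ a k u ∧ v <:+: wordApply (down σ k) u := by
  induction k with
  | zero => exact ⟨0, fun v hv _ => ⟨v, hv, by rw [wordApply_down_zero]⟩⟩
  | succ k ih =>
    obtain ⟨L, hL⟩ := ih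
    obtain ⟨M, hM⟩ := exists_length_le (down σ k)
    refine ⟨max L M, fun v hv hlen => ?_⟩
    obtain ⟨u, hu, hvu⟩ := hL v hv (by omega)
    have hu₁ : 1 < u.length := by
      by_contra! hcon
      have h₁ := length_wordApply_le hM u
      have h₂ := hvu.length_le
      have h₃ := Nat.mul_le_mul_left M hcon
      omega
    obtain ⟨w, hw, huw⟩ := hu.exists_image hu₁
    exact ⟨w, hw, wordApply_down_succ σ k w ▸ hvu.trans (wordApply_isInfix _ huw)⟩

theorem exists_image_down_of_mem [∀ n, Finite (A n)] {x : ℤ → A 0} (hx : x ∈ XX σ a 0)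
    (k : ℕ) (i : ℤ) (m : ℕ) :
    ∃ u, Factor σ a k u ∧ seg x i m <:+: wordApply (down σ k) u := by
  obtain ⟨L, hL⟩ := Factor.exists_image_down (σ := σ) (a := a) k
  obtain ⟨u, hu, h⟩ := hL _ (mem_XX_iff.1 hx i (m + L + 1)) (by rw [length_seg]; omega)
  exact ⟨u, hu, (seg_infix_seg x le_rfl (by push_cast; omega)).trans h⟩

theorem ProperMorphism.ne_nil {B C : Type*} {f : B → List C} (h : ProperMorphism f) (b : B) :
    f b ≠ [] := by
  obtain ⟨l, r, h⟩ := h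
  intro hb
  simpa [hb] using h b

theorem length_down_pos (hσ : ∀ n c, σ n c ≠ []) (k : ℕ) (c : A k) :
    0 < (down σ k c).length := by
  induction k with
  | zero => simp [down]
  | succ k ih =>
    rw [down_succ]
    exact (List.length_pos_of_ne_nil (hσ k c)).trans_le (length_le_length_wordApply ih _)

theorem exists_mem_Atom [∀ n, Finite (A n)] [∀ n, Nonempty (A n)]
    (hσ : ∀ n c, σ n c ≠ []) {x : ℤ → A 0} (hx : x ∈ XX σ a 0) (k : ℕ) :
    ∃ c j, j < (down σ k c).length ∧ x ∈ Atom σ a k c j := by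
  obtain ⟨y, j, hy, hj, hext⟩ := exists_desubstitution (length_down_pos hσ k)
    (fun v w h hw => Factor.sub h hw) (exists_image_down_of_mem hx k)
  refine ⟨y 0, j, hj, y, _, mem_XX_iff.2 hy, rfl, hext, ?_⟩
  funext i
  simp [shiftBy]

theorem exists_factor_length [∀ n, Finite (A n)] {x : ℤ → A 0} (hx : x ∈ XX σ a 0)
    (k Q : ℕ) : ∃ u, Factor σ a k u ∧ Q ≤ u.length := by
  obtain ⟨M, hM⟩ := exists_length_le (down σ k)
  obtain ⟨u, hu, h⟩ := exists_image_down_of_mem hx k 0 (M * Q + 1)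
  refine ⟨u, hu, ?_⟩
  have h₁ := length_wordApply_le hM u
  have h₂ := h.length_le
  rw [length_seg] at h₂
  by_contra! hcon
  have := Nat.mul_le_mul_left M hcon.le
  omega

/-- If the letter `l` is fixed by all morphisms from some level on and ends all images,
then arbitrary powers of it occur in the language. -/
theorem factor_replicate [∀ n, Finite (A n)] (hσ : ∀ n c, σ n c ≠ []) {x : ℤ → A 0}
    (hx : x ∈ XX σ a 0) {l : ∀ n, A n} {n : ℕ}
    (hlast : ∀ k ≥ n, ∀ c, (σ k c).getLast? = some (l k))
    (hfix : ∀ k ≥ n, σ k (l (k + 1)) = [l k]) (Q : ℕ) :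
    Factor σ a n (List.replicate Q (l n)) := by
  have hstep : ∀ p ≤ Q, ∀ k ≥ n, ∃ s : List (A k), Q ≤ (s ++ List.replicate p (l k)).length ∧
      Factor σ a k (s ++ List.replicate p (l k)) := by
    intro p hp
    induction p with
    | zero =>
      intro k _
      obtain ⟨u, hu, hQ⟩ := exists_factor_length hx k Q
      exact ⟨u, by simpa using hQ, by simpa using hu⟩
    | succ p ih =>
      intro k hk
      obtain ⟨s, hs, hfac⟩ := ih (by omega) (k + 1) (by omega)
      have hrep : wordApply (σ k) (List.replicate p (l (k + 1))) =
          List.replicate p (l k) := by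
        simp [wordApply, hfix k hk]
      have hsne : s ≠ [] := by
        rintro rfl
        simp at hs
        omega
      obtain ⟨s', b, rfl⟩ := List.eq_nil_or_concat s |>.resolve_left hsne
      obtain ⟨e, he⟩ := List.getLast?_eq_some_iff.1 (hlast k hk b)
      have heq : wordApply (σ k) (s'.concat b ++ List.replicate p (l (k + 1))) =
          (wordApply (σ k) s' ++ e) ++ List.replicate (p + 1) (l k) := by
        rw [wordApply_append, hrep, List.concat_eq_append, wordApply_append,
          wordApply_singleton, he, List.replicate_succ]
        simp
      refine ⟨wordApply (σ k) s' ++ e, ?_, heq ▸ hfac.image⟩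
      rw [← heq]
      exact hs.trans (length_le_length_wordApply
        (fun c => List.length_pos_of_ne_nil (hσ k c)) _)
  obtain ⟨s, _, hs⟩ := hstep Q le_rfl n le_rfl
  exact .sub (List.suffix_append _ _).isInfix hs

theorem getElem?_wordApply_replicate {B C : Type*} {f : B → List C} {b : B} {Q s : ℕ}
    (hs : s < Q * (f b).length) :
    (wordApply f (List.replicate Q b))[s]? = (f b)[s % (f b).length]? := by
  induction Q generalizing s with
  | zero => omega
  | succ Q ih =>
    rw [List.replicate_succ, wordApply_cons]
    rcases lt_or_ge s (f b).length with h | h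
    · rw [List.getElem?_append_left h, Nat.mod_eq_of_lt h]
    · rw [List.getElem?_append_right h, ih (by rw [Nat.succ_mul] at hs; omega),
        Nat.mod_eq_sub_mod h]

theorem exists_periodic_mem_XX {k : ℕ} {c : A k} (hpos : 0 < (down σ k c).length)
    (h : ∀ Q, Factor σ a k (List.replicate Q c)) :
    ∃ x ∈ XX σ a 0, ∃ p : ℕ, 1 ≤ p ∧ shiftBy (p : ℤ) x = x := by
  set w := down σ k c with hw
  have hw0 : (w.length : ℤ) ≠ 0 := by omega
  refine ⟨fun i => w[(i % w.length).toNat]'(by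
    have := Int.emod_nonneg i hw0
    have := Int.emod_lt_of_pos i (by omega : (0 : ℤ) < w.length)
    omega), mem_XX_iff.2 fun i m => ?_, w.length, hpos, by funext i; simp [shiftBy]⟩
  have h₁ := Int.emod_nonneg i hw0
  obtain ⟨p, hp⟩ := Int.eq_ofNat_of_zero_le h₁
  have hle : p + m ≤ (p + m) * w.length := Nat.le_mul_of_pos_right _ hpos
  refine .sub (seg_infix_of_offset (p := p) ?_ fun s hs => ?_) (h (p + m)).wordApply_down
  · simpa [wordApply] using hle
  · rw [getElem?_wordApply_replicate (by rw [← hw]; omega), ← hw,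
      List.getElem?_eq_getElem (Nat.mod_lt _ hpos)]
    congr 2
    rw [Int.add_emod, hp]
    zify
    rw [Int.toNat_of_nonneg (Int.emod_nonneg _ hw0)]
    simp

theorem shiftBy_eq_of_mem_closure {B : Type*} [TopologicalSpace B] [T2Space B]
    {x y : ℤ → B} {p : ℤ} (hx : shiftBy p x = x)
    (hy : y ∈ closure {z | ∃ q : ℤ, z = shiftBy q x}) : shiftBy p y = y := by
  have hclosed : IsClosed {z : ℤ → B | shiftBy p z = z} :=
    isClosed_eq (continuous_pi fun i => continuous_apply (i + p)) continuous_id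
  refine closure_minimal ?_ hclosed hy
  rintro _ ⟨q, rfl⟩
  funext i
  have := congrFun hx (i + q)
  simp only [shiftBy] at this ⊢
  rwa [add_right_comm]

theorem Nat.exists_eventually_const_of_monotone {f : ℕ → ℕ} (hf : Monotone f) {N : ℕ}
    (hN : ∀ k, f k ≤ N) : ∃ n, ∀ k ≥ n, f k = f n := by
  obtain ⟨n, hn⟩ : ∃ n, ∀ k, f k ≤ f n := by
    have hfin : (Set.range f).Finite := (Set.finite_Iic N).subset (by
      rintro _ ⟨k, rfl⟩; exact hN k)
    obtain ⟨_, ⟨⟨n, rfl⟩, hn⟩⟩ := hfin.exists_maximal (Set.range_nonempty f)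
    exact ⟨n, fun k => not_lt.1 fun hlt => absurd (hn ⟨k, rfl⟩ hlt.le) (not_le.2 hlt)⟩
  exact ⟨n, fun k hk => (hn k).antisymm (hf hk)⟩

/-- In the absence of periodic points, the towers of a proper directive sequence become
arbitrarily high. -/
theorem exists_forall_lt_length_down [∀ n, Finite (A n)]
    (hproper : ∀ n, ProperMorphism (σ n)) {x : ℤ → A 0} (hx : x ∈ XX σ a 0)
    (hnonper : ∀ x ∈ XX σ a 0, ∀ p : ℕ, 1 ≤ p → shiftBy (p : ℤ) x ≠ x) (N : ℕ) :
    ∃ k, ∀ c, N < (down σ k c).length := by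
  by_contra! hcon
  have hσ : ∀ n c, σ n c ≠ [] := fun n => (hproper n).ne_nil
  have hpos := length_down_pos hσ
  choose l r hlr using hproper
  have hhead : ∀ k c, ∃ e, σ k c = l k :: e := fun k c =>
    List.head?_eq_some_iff.1 (hlr k c).1
  have hlen : ∀ k c, (down σ k (l k)).length ≤ (down σ (k + 1) c).length := by
    intro k c
    obtain ⟨e, he⟩ := hhead k c
    rw [down_succ, he, wordApply_cons, List.length_append]
    omega
  have hmono : Monotone fun k => (down σ k (l k)).length :=
    monotone_nat_of_le_succ fun k => hlen k _
  obtain ⟨n, hn⟩ := Nat.exists_eventually_const_of_monotone hmono (N := N) fun k => by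
    obtain ⟨c, hc⟩ := hcon (k + 1)
    exact (hlen k c).trans hc
  have hfix : ∀ k ≥ n, σ k (l (k + 1)) = [l k] := by
    intro k hk
    obtain ⟨e, he⟩ := hhead k (l (k + 1))
    have h₁ := (hn (k + 1) (by omega)).trans (hn k hk).symm
    have h₂ := length_le_length_wordApply (hpos k) e
    simp only [down_succ, he, wordApply_cons, List.length_append] at h₁
    rw [he, List.eq_nil_of_length_eq_zero (by omega : e.length = 0)]
  have hr : ∀ k ≥ n, r k = l k := by
    intro k hk
    have := (hlr k (l (k + 1))).2
    rw [hfix k hk] at this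
    simpa using this.symm
  obtain ⟨z, hz, p, hp, hzp⟩ := exists_periodic_mem_XX (hpos n (l n))
    (factor_replicate hσ hx (fun k hk c => hr k hk ▸ (hlr k c).2) hfix)
  exact hnonper z hz p hp hzp

/-- Two images of sequences with the same letter at the origin agree around the image of
this letter, when all images of letters start and end with common words. -/
theorem eq_of_ExtSeq_of_eq_zero {B C : Type*} {f : B → List C} {u v : List C}
    (hu : ∀ b, u <+: f b) (hv : ∀ b, v <:+ f b) {y y' : ℤ → B} {z z' : ℤ → C}
    (hz : ExtSeq f y z) (hz' : ExtSeq f y' z') (h0 : y 0 = y' 0) {i : ℤ}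
    (hi : -v.length ≤ i) (hi' : i < (f (y 0)).length + u.length) : z i = z' i := by
  have key : ∀ {y : ℤ → B} {z : ℤ → C}, ExtSeq f y z → ∀ {i : ℤ}, -v.length ≤ i →
      i < (f (y 0)).length + u.length →
      some (z i) = (v ++ f (y 0) ++ u)[(i + v.length).toNat]? := by
    intro y z hz i hi hi'
    have hcum₁ : cum (fun j => (f (y j)).length) 1 = (f (y 0)).length := by
      rw [← zero_add (1 : ℤ), cum_succ, cum_zero, zero_add]
    have hcum₂ : cum (fun j => (f (y j)).length) (-1) = -(f (y (-1))).length := by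
      have := cum_succ (fun j => (f (y j)).length) (-1)
      rw [neg_add_cancel, cum_zero] at this
      linarith
    have h₀ := hz 0
    have h₁ := hz 1
    have h₂ := hz (-1)
    rw [cum_zero] at h₀
    rw [hcum₁] at h₁
    rw [hcum₂] at h₂
    rcases lt_or_ge i 0 with hneg | hnonneg
    · obtain ⟨e, he⟩ := hv (y (-1))
      have hlen := congrArg List.length he
      rw [List.length_append] at hlen
      have := getElem?_eq_of_seg_eq h₂ (s := (i + (f (y (-1))).length).toNat) (by omega)
      rw [← he, List.getElem?_append_right (by rw [he]; omega), he] at this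
      rw [List.append_assoc, List.getElem?_append_left (by omega),
        show (i + v.length).toNat = (i + (f (y (-1))).length).toNat - e.length by omega, this]
      congr 2
      omega
    · rcases lt_or_ge i (f (y 0)).length with hlt | hge
      · have := getElem?_eq_of_seg_eq h₀ (s := i.toNat) (by omega)
        rw [List.append_assoc, List.getElem?_append_right (by omega),
          List.getElem?_append_left (by omega),
          show (i + v.length).toNat - v.length = i.toNat by omega, this]
        congr 2
        omega
      · obtain ⟨e, he⟩ := hu (y 1)
        have hlen := congrArg List.length he
        rw [List.length_append] at hlen
        have := getElem?_eq_of_seg_eq h₁ (s := (i - (f (y 0)).length).toNat) (by omega)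
        rw [← he, List.getElem?_append_left (by omega)] at this
        rw [List.getElem?_append_right (by rw [List.length_append]; omega), List.length_append,
          show (i + v.length).toNat - (v.length + (f (y 0)).length) =
            (i - (f (y 0)).length).toNat by omega, this]
        congr 2
        omega
  have h := key hz hi hi'
  rw [h0, ← key hz' hi (h0 ▸ hi')] at h
  exact Option.some_inj.1 h

end Sadic

/-- Let `X = XX σ a 0` be the minimal non-periodic S-adic subshift defined by a
directive sequence of proper morphisms whose concatenation extensions are one-to-one,
and let `τ_k = σ 0 ∘ ⋯ ∘ σ (k-1)`.  Then the sequence of partitions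
`P(k) = { T^j τ_k([c]) : c ∈ A k, 0 ≤ j < |τ_k(c)| }` (for `k ≥ 1`) generates the
topology of `X`: any two distinct points of `X` are separated by some atom. -/
theorem sadic_tower_generates_topology {A : ℕ → Type*} [∀ n, Fintype (A n)]
    [∀ n, Nonempty (A n)] [∀ n, TopologicalSpace (A n)] [∀ n, DiscreteTopology (A n)]
    (σ : ∀ n, A (n + 1) → List (A n)) (a : ∀ n, A n)
    (hproper : ∀ n, ProperMorphism (σ n))
    (hmin : ∀ x ∈ XX σ a 0, XX σ a 0 ⊆ closure { z | ∃ p : ℤ, z = shiftBy p x })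
    (hnonper : ∃ x ∈ XX σ a 0, ∀ p : ℕ, 1 ≤ p → shiftBy (p : ℤ) x ≠ x)
    (hwd : ∀ n, ∀ y ∈ XX σ a (n + 1), ∀ z, ExtSeq (σ n) y z → z ∈ XX σ a n)
    (hinj : ∀ n, ∀ y ∈ XX σ a (n + 1), ∀ y' ∈ XX σ a (n + 1), ∀ z,
      ExtSeq (σ n) y z → ExtSeq (σ n) y' z → y = y') :
    ∀ x ∈ XX σ a 0, ∀ y ∈ XX σ a 0, x ≠ y →
      ∃ (k : ℕ), 1 ≤ k ∧ ∃ (c : A k) (j : ℕ), j < (down σ k c).length ∧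
        x ∈ Atom σ a k c j ∧ y ∉ Atom σ a k c j := by
  have hσ : ∀ n c, σ n c ≠ [] := fun n => (hproper n).ne_nil
  have hnonper' : ∀ x ∈ XX σ a 0, ∀ p : ℕ, 1 ≤ p → shiftBy (p : ℤ) x ≠ x := by
    intro x hx p hp hxp
    obtain ⟨y, hy, hyp⟩ := hnonper
    exact hyp p hp (shiftBy_eq_of_mem_closure hxp (hmin x hx hy))
  intro x hx y hy hxy
  obtain ⟨i, hi⟩ := Function.ne_iff.1 hxy
  obtain ⟨k, hk⟩ := exists_forall_lt_length_down hproper hx hnonper' i.natAbs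
  obtain ⟨c, j, hj, hxc⟩ := exists_mem_Atom hσ hx (k + 1)
  refine ⟨k + 1, by omega, c, j, hj, hxc, fun hyc => hi ?_⟩
  obtain ⟨u, z, -, hu, hz, rfl⟩ := hxc
  obtain ⟨u', z', -, hu', hz', rfl⟩ := hyc
  obtain ⟨l, r, hlr⟩ := hproper k
  have hl := hk l
  have hr := hk r
  refine eq_of_ExtSeq_of_eq_zero (u := down σ k l) (v := down σ k r) (fun b => ?_)
    (fun b => ?_) hz hz' (hu.trans hu'.symm) (by omega) (by rw [hu]; omega)
  · obtain ⟨e, he⟩ := List.head?_eq_some_iff.1 (hlr b).1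
    rw [down_succ, he, wordApply_cons]
    exact List.prefix_append _ _
  · obtain ⟨e, he⟩ := List.getLast?_eq_some_iff.1 (hlr b).2
    rw [down_succ, he, wordApply_append, wordApply_singleton]
    exact List.suffix_append _ _
end

section
/- Let A be a finite alphabet and x ∈ A^ℕ. Then the complexity of x is sub-affine, i.e., there exists a constant C such that p_x(n) ≤ C·n for all n ≥ 1, if and only if the sequence of first differences (p_x(n+1) − p_x(n))_{n≥1} is bounded. (Cassaigne's theorem.) -/
/-- The factor `x_i x_{i+1} ⋯ x_{i+n-1}` of the infinite sequence `x`. -/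
def segN {A : Type*} (x : ℕ → A) (i n : ℕ) : List A :=
  (List.range n).map fun k => x (i + k)

/-- The set of factors of length `n` of the infinite sequence `x`. -/
def factors {A : Type*} (x : ℕ → A) (n : ℕ) : Set (List A) :=
  { w | ∃ i : ℕ, segN x i n = w }

/-- The word complexity of `x`: the number of distinct factors of length `n`. -/
noncomputable def complexityN {A : Type*} (x : ℕ → A) (n : ℕ) : ℕ :=
  (factors x n).ncard

section TwoSided

variable {A : Type*}

/-- The word of length `n` of the two-sided sequence `y` that ends just before position `e`. -/
def wordBefore (y : ℤ → A) (n : ℕ) (e : ℤ) : List A :=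
  (List.range n).map fun k : ℕ => y (e - n + k)

/-- The words of length `n` of `y` ending just before `e` and just before `e'` coincide. -/
def AgreeBefore (y : ℤ → A) (n e e' : ℤ) : Prop :=
  ∀ k : ℤ, 1 ≤ k → k ≤ n → y (e - k) = y (e' - k)

/-- The word of length `n` of `y` ending just before `e` is right special. -/
def IsSpecialAt (y : ℤ → A) (n e : ℤ) : Prop :=
  ∃ e', AgreeBefore y n e e' ∧ y e ≠ y e'

/-- The word of length `h + q` of `y` ending just before `e` has period `q`. -/
def HasPeriodBefore (y : ℤ → A) (h q e : ℤ) : Prop :=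
  AgreeBefore y h e (e - q)

lemma wordBefore_eq_iff (y : ℤ → A) (n : ℕ) (e e' : ℤ) :
    wordBefore y n e = wordBefore y n e' ↔ AgreeBefore y n e e' := by
  simp only [wordBefore, List.map_inj_left, List.mem_range, AgreeBefore]
  constructor
  · intro h k h1 h2
    have := h (n - k).toNat (by omega)
    have h3 : (((n - k).toNat : ℕ) : ℤ) = n - k := by omega
    rw [h3] at this
    convert this using 2 <;> ring
  · intro h k hk
    have := h (n - k) (by omega) (by omega)
    convert this using 2 <;> ring

lemma AgreeBefore.symm {y : ℤ → A} {n e e' : ℤ} (h : AgreeBefore y n e e') :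
    AgreeBefore y n e' e := fun k h1 h2 => (h k h1 h2).symm

lemma AgreeBefore.trans {y : ℤ → A} {n e e' c : ℤ} (h : AgreeBefore y n e e')
    (h' : AgreeBefore y n e' c) : AgreeBefore y n e c :=
  fun k h1 h2 => (h k h1 h2).trans (h' k h1 h2)

lemma AgreeBefore.mono {y : ℤ → A} {n m e e' : ℤ} (h : AgreeBefore y n e e') (hm : m ≤ n) :
    AgreeBefore y m e e' := fun k h1 h2 => h k h1 (h2.trans hm)

lemma AgreeBefore.shift {y : ℤ → A} {n m e e' : ℤ} (s : ℤ) (h : AgreeBefore y n e e')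
    (hs : 0 ≤ s) (hm : m + s ≤ n) : AgreeBefore y m (e - s) (e' - s) := by
  intro k h1 h2
  have := h (k + s) (by omega) (by omega)
  convert this using 2 <;> ring

lemma HasPeriodBefore.congr {y : ℤ → A} {h q n e e' : ℤ} (hp : HasPeriodBefore y h q e)
    (ha : AgreeBefore y n e e') (hq : 0 ≤ q) (hn : h + q ≤ n) : HasPeriodBefore y h q e' :=
  ((ha.mono (by omega)).symm.trans hp).trans (ha.shift q hq hn)

lemma AgreeBefore.hasPeriodBefore {y : ℤ → A} {n h e e' : ℤ} (ha : AgreeBefore y n e e')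
    (hn : h + |e' - e| ≤ n) : HasPeriodBefore y h |e' - e| e := by
  rcases le_total e' e with hle | hle
  · have h1 : |e' - e| = e - e' := by rw [abs_of_nonpos (by omega)]; ring
    rw [h1] at hn ⊢
    unfold HasPeriodBefore
    rw [sub_sub_cancel]
    exact ha.mono (by omega)
  · have h1 : |e' - e| = e' - e := abs_of_nonneg (by omega)
    rw [h1] at hn ⊢
    have := (ha.shift (m := h) (e' - e) (by omega) hn).symm
    rwa [sub_sub_cancel] at this

/-- Two nearby positions cannot both interrupt a long run with a small period. -/
lemma eq_of_period_broken {y : ℤ → A} {d q q' f f' : ℤ} (hff : f ≤ f') (hfd : f' < f + d)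
    (hq : 1 ≤ q) (hqd : q < 2 * d) (hq' : 1 ≤ q') (hqd' : q' < 2 * d)
    (hp : HasPeriodBefore y (3 * d) q f) (hp' : HasPeriodBefore y (3 * d) q' f')
    (hb : y f ≠ y (f - q)) : f = f' := by
  by_contra hne
  apply hb
  have h1 := hp' (f' - f) (by omega) (by omega)
  have h2 := hp q' (by omega) (by omega)
  have h3 := hp' (f' - f + q) (by omega) (by omega)
  rw [show f' - (f' - f) = f by ring, show f' - q' - (f' - f) = f - q' by ring] at h1
  rw [show f' - (f' - f + q) = f - q by ring,
    show f' - q' - (f' - f + q) = f - q - q' by ring] at h3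
  rw [h1, h2, h3]

/-- The key separation of words that leave a common aperiodic stretch. -/
lemma eq_of_agreeBefore_branches {y : ℤ → A} {n d f g f' g' j l : ℤ} (hn : 8 * d ≤ n)
    (hfg : f < g + d) (hgf : g < f + d) (hl : 1 ≤ l) (hlj : l ≤ j) (hj : j ≤ d)
    (hf : AgreeBefore y n f f') (hfs : y f ≠ y f') (hg : AgreeBefore y n g g')
    (hap : ∀ q, 1 ≤ q → q < 2 * d → ¬ HasPeriodBefore y (3 * d) q f)
    (h : AgreeBefore y n (f' + j) (g' + l)) : f = g ∧ j = l := by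
  have hG : AgreeBefore y (n - j) f (g - (j - l)) := by
    have h1 := h.shift (m := n - j) j (by omega) (by omega)
    rw [show f' + j - j = f' by ring, show g' + l - j = g' - (j - l) by ring] at h1
    exact ((hf.mono (by omega)).trans h1).trans
      (hg.shift (m := n - j) (j - l) (by omega) (by omega)).symm
  by_cases heq : g - (j - l) = f
  · by_cases hjl : j = l
    · omega
    · exfalso
      apply hfs
      have h1 := h j (by omega) (by omega)
      have h2 := hg (j - l) (by omega) (by omega)
      rw [show f' + j - j = f' by ring, show g' + l - j = g' - (j - l) by ring] at h1
      rw [h1, ← h2, heq]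
  · exfalso
    have hlt : |g - (j - l) - f| < 2 * d := by rw [abs_lt]; constructor <;> omega
    have hpos : 1 ≤ |g - (j - l) - f| := Int.one_le_abs (by omega)
    exact hap _ hpos hlt (hG.hasPeriodBefore (by omega))

/-- The position `f` interrupts a long run with a small period. -/
def BreaksPeriod (y : ℤ → A) (d f : ℤ) : Prop :=
  ∃ q, 1 ≤ q ∧ q < 2 * d ∧ HasPeriodBefore y (3 * d) q f ∧ y f ≠ y (f - q)

/-- The position `f` follows a right special word without small periods. -/
def IsAperiodicSpecial (y : ℤ → A) (n d f : ℤ) : Prop :=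
  IsSpecialAt y n f ∧ ∀ q, 1 ≤ q → q < 2 * d → ¬ HasPeriodBefore y (3 * d) q f

lemma BreaksPeriod.congr {y : ℤ → A} {n d e f : ℤ} (hn : 8 * d ≤ n) (h : BreaksPeriod y d e)
    (ha : AgreeBefore y n e f) (hy : y e = y f) : BreaksPeriod y d f := by
  obtain ⟨q, h1, h2, h3, h4⟩ := h
  refine ⟨q, h1, h2, h3.congr ha (by omega) (by omega), ?_⟩
  rwa [← hy, ← ha q (by omega) (by omega)]

lemma IsAperiodicSpecial.congr {y : ℤ → A} {n d e f : ℤ} (hn : 8 * d ≤ n)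
    (h : IsAperiodicSpecial y n d e) (ha : AgreeBefore y n e f) (hy : y e = y f) :
    IsAperiodicSpecial y n d f := by
  obtain ⟨⟨e', h1, h2⟩, h3⟩ := h
  refine ⟨⟨e', ha.symm.trans h1, by rwa [← hy]⟩, fun q hq hqd hp => h3 q hq hqd ?_⟩
  exact hp.congr ha.symm (by omega) (by omega)

lemma IsSpecialAt.exists_agreeBefore {y : ℤ → A} {n d e : ℤ} (hn : 8 * d ≤ n)
    (h : IsSpecialAt y n e) :
    ∃ f, AgreeBefore y n e f ∧ (BreaksPeriod y d f ∨ IsAperiodicSpecial y n d f) := by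
  by_cases hp : ∃ q, 1 ≤ q ∧ q < 2 * d ∧ HasPeriodBefore y (3 * d) q e
  · obtain ⟨q, h1, h2, h3⟩ := hp
    obtain ⟨e', he, hne⟩ := h
    by_cases hb : y e = y (e - q)
    · refine ⟨e', he, Or.inl ⟨q, h1, h2, h3.congr he (by omega) (by omega), fun hb' => hne ?_⟩⟩
      rw [hb, hb', he q (by omega) (by omega)]
    · exact ⟨e, fun _ _ _ => rfl, Or.inl ⟨q, h1, h2, h3, hb⟩⟩
  · push Not at hp
    exact ⟨e, fun _ _ _ => rfl, Or.inr ⟨h, hp⟩⟩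

open scoped Classical in
lemma card_breaksPeriod_le (y : ℤ → A) (d : ℕ) (Q : ℤ) :
    ((Finset.range d).filter fun s : ℕ => BreaksPeriod y d (Q + s)).card ≤ 1 := by
  have key : ∀ s t : ℕ, s ≤ t → t < d → BreaksPeriod y d (Q + s) → BreaksPeriod y d (Q + t) →
      s = t := by
    rintro s t hst htd ⟨q, h1, h2, h3, h4⟩ ⟨q', h1', h2', h3', -⟩
    have := eq_of_period_broken (by omega) (by omega) h1 h2 h1' h2' h3 h3' h4
    omega
  rw [Finset.card_le_one]
  intro s hs t ht
  simp only [Finset.mem_filter, Finset.mem_range] at hs ht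
  rcases le_total s t with h | h
  · exact key s t h ht.1 hs.2 ht.2
  · exact (key t s h hs.1 ht.2 hs.2).symm

variable [Finite A]

lemma finite_range_wordBefore (y : ℤ → A) (n : ℕ) : (Set.range (wordBefore y n)).Finite := by
  refine (List.finite_length_eq A n).subset ?_
  rintro _ ⟨e, rfl⟩
  simp [wordBefore]

open scoped Classical in
lemma card_image_wordBefore_le {ι : Type*} {y : ℤ → A} {C : ℕ}
    (H : ∀ n : ℕ, 1 ≤ n → (Set.range (wordBefore y n)).ncard ≤ C * n) {n : ℕ} (hn : 1 ≤ n)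
    (S : Finset ι) (φ : ι → ℤ) : (S.image fun a => wordBefore y n (φ a)).card ≤ C * n := by
  refine le_trans ?_ (H n hn)
  rw [← Set.ncard_coe_finset]
  refine Set.ncard_le_ncard ?_ (finite_range_wordBefore y n)
  intro w hw
  simp only [Finset.coe_image, Set.mem_image] at hw
  obtain ⟨a, -, rfl⟩ := hw
  exact ⟨_, rfl⟩

open scoped Classical in
lemma card_isAperiodicSpecial_le {y : ℤ → A} {C : ℕ}
    (H : ∀ n : ℕ, 1 ≤ n → (Set.range (wordBefore y n)).ncard ≤ C * n) {n d : ℕ} (hd : 1 ≤ d)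
    (hn : 8 * d ≤ n) (hn' : n ≤ 16 * d) (Q : ℤ) :
    ((Finset.range d).filter fun s : ℕ => IsAperiodicSpecial y n d (Q + s)).card ≤ 16 * C := by
  set F := (Finset.range d).filter fun s : ℕ => IsAperiodicSpecial y n d (Q + s) with hF
  have hmem : ∀ s ∈ F, s < d ∧ IsAperiodicSpecial y n d (Q + s) := by
    intro s hs
    simpa [hF] using hs
  have hbr : ∀ s : ℕ, ∃ f', s ∈ F → AgreeBefore y n (Q + s) f' ∧ y (Q + s) ≠ y f' := by
    intro s
    by_cases hs : s ∈ F
    · obtain ⟨-, ⟨f', hf'⟩, -⟩ := hmem s hs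
      exact ⟨f', fun _ => hf'⟩
    · exact ⟨0, fun h => absurd h hs⟩
  choose b hb using hbr
  have hcard := card_image_wordBefore_le H (n := n) (by omega) (F ×ˢ Finset.Icc 1 d)
    (fun a => b a.1 + a.2)
  rw [Finset.card_image_of_injOn, Finset.card_product, Nat.card_Icc, Nat.add_sub_cancel] at hcard
  · have : F.card * d ≤ 16 * C * d := by nlinarith
    exact Nat.le_of_mul_le_mul_right this hd
  · have key : ∀ s t j l : ℕ, s ∈ F → t ∈ F → 1 ≤ l → l ≤ j → j ≤ d →
        AgreeBefore y n (b s + j) (b t + l) → s = t ∧ j = l := by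
      intro s t j l hs ht h1 h2 h3 h
      have hs' := hmem s hs
      have ht' := hmem t ht
      have := eq_of_agreeBefore_branches (d := d) (f := Q + s) (g := Q + t) (by omega) (by omega)
        (by omega) (by omega) (by omega) (by omega) (hb s hs).1 (hb s hs).2 (hb t ht).1
        hs'.2.2 h
      omega
    rintro ⟨s, j⟩ hs ⟨t, l⟩ ht h
    simp only [Finset.coe_product, Set.mem_prod, Finset.mem_coe, Finset.mem_Icc] at hs ht
    have h' := (wordBefore_eq_iff _ _ _ _).1 h
    rcases le_total l j with hlj | hlj
    · have := key s t j l hs.1 ht.1 ht.2.1 hlj hs.2.2 h'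
      rw [this.1, this.2]
    · have := key t s l j ht.1 hs.1 hs.2.1 hlj ht.2.2 h'.symm
      rw [this.1, this.2]

open scoped Classical in
/-- A two-sided sequence of sub-linear complexity has boundedly many right special words of each
length. -/
lemma card_isSpecialAt_le {y : ℤ → A} {C : ℕ}
    (H : ∀ n : ℕ, 1 ≤ n → (Set.range (wordBefore y n)).ncard ≤ C * n) {n : ℕ} (hn : 8 ≤ n)
    (T : Finset ℤ) (hT : ∀ e ∈ T, IsSpecialAt y n e)
    (hinj : ∀ e ∈ T, ∀ e' ∈ T, AgreeBefore y n e e' → e = e') :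
    T.card ≤ (16 * C + 1) * (17 * C) := by
  obtain ⟨d, hd, hnd, hnd'⟩ : ∃ d : ℕ, 1 ≤ d ∧ 8 * d ≤ n ∧ n ≤ 16 * d :=
    ⟨n / 8, by omega, by omega, by omega⟩
  have hex : ∀ e : ℤ, ∃ f, e ∈ T →
      AgreeBefore y n e f ∧ (BreaksPeriod y d f ∨ IsAperiodicSpecial y n d f) := by
    intro e
    by_cases he : e ∈ T
    · obtain ⟨f, hf⟩ := (hT e he).exists_agreeBefore (d := d) (by omega)
      exact ⟨f, fun _ => hf⟩
    · exact ⟨0, fun h => absurd h he⟩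
  choose g hg using hex
  set φ : ℤ × ℕ → List A := fun a => wordBefore y (n + d) (g a.1 - a.2 + d) with hφ
  have hfib : ∀ w ∈ (T ×ˢ Finset.range d).image φ,
      ((T ×ˢ Finset.range d).filter fun a => φ a = w).card ≤ 16 * C + 1 := by
    intro w hw
    obtain ⟨a₀, -, rfl⟩ := Finset.mem_image.1 hw
    set P : ℤ := g a₀.1 - a₀.2 + d with hP
    have hmem : ∀ a : ℤ × ℕ, a ∈ (T ×ˢ Finset.range d).filter (fun a => φ a = φ a₀) →
        a.1 ∈ T ∧ a.2 < d ∧ AgreeBefore y (n + d) (g a.1 - a.2 + d) P := by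
      intro a ha
      simp only [Finset.mem_filter, Finset.mem_product, Finset.mem_range] at ha
      refine ⟨ha.1.1, ha.1.2, ?_⟩
      have := (wordBefore_eq_iff _ _ _ _).1 ha.2
      push_cast at this
      exact this
    have hshift : ∀ a : ℤ × ℕ, a ∈ (T ×ˢ Finset.range d).filter (fun a => φ a = φ a₀) →
        AgreeBefore y n (g a.1) (P - d + a.2) ∧ y (g a.1) = y (P - d + a.2) := by
      intro a ha
      obtain ⟨-, h2, h3⟩ := hmem a ha
      have h4 := h3.shift (m := n) (d - a.2) (by omega) (by omega)
      have h5 := h3 (d - a.2) (by omega) (by omega)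
      rw [show g a.1 - a.2 + d - (d - a.2) = g a.1 by ring,
        show P - (d - a.2) = P - d + a.2 by ring] at h4 h5
      exact ⟨h4, h5⟩
    calc _ ≤ ((Finset.range d).filter fun s : ℕ =>
            BreaksPeriod y d (P - d + s) ∨ IsAperiodicSpecial y n d (P - d + s)).card := by
          refine Finset.card_le_card_of_injOn Prod.snd ?_ ?_
          · intro a ha
            obtain ⟨h1, h2, -⟩ := hmem a ha
            obtain ⟨h3, h4⟩ := hshift a ha
            simp only [Finset.coe_filter, Set.mem_ofPred_eq, Finset.mem_range]
            exact ⟨h2, (hg _ h1).2.imp (fun h => h.congr (by omega) h3 h4)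
              (fun h => h.congr (by omega) h3 h4)⟩
          · rintro ⟨e, s⟩ ha ⟨e', s'⟩ ha' (rfl : s = s')
            have h1 := (hmem _ ha).1
            have h1' := (hmem _ ha').1
            have h2 := (hshift _ ha).1
            have h2' := (hshift _ ha').1
            have := hinj e h1 e' h1'
              (((hg e h1).1.trans (h2.trans h2'.symm)).trans (hg e' h1').1.symm)
            rw [this]
      _ ≤ 1 + 16 * C := by
          rw [Finset.filter_or]
          exact (Finset.card_union_le _ _).trans
            (add_le_add (card_breaksPeriod_le y d _) (card_isAperiodicSpecial_le H hd hnd hnd' _))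
      _ = 16 * C + 1 := add_comm _ _
  have h1 := Finset.card_le_mul_card_image (f := φ) (T ×ˢ Finset.range d) _ hfib
  have h2 := card_image_wordBefore_le H (n := n + d) (by omega) (T ×ˢ Finset.range d)
    (fun a => g a.1 - a.2 + d)
  rw [Finset.card_product, Finset.card_range] at h1
  have h3 : C * (n + d) ≤ 17 * C * d := by nlinarith
  have h4 : T.card * d ≤ (16 * C + 1) * (17 * C) * d := by
    refine h1.trans ?_
    rw [mul_assoc (16 * C + 1)]
    exact Nat.mul_le_mul_left _ (h2.trans h3)
  exact Nat.le_of_mul_le_mul_right h4 hd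

end TwoSided

section OneSided

variable {A : Type*}

lemma segN_succ (x : ℕ → A) (i n : ℕ) : segN x i (n + 1) = segN x i n ++ [x (i + n)] := by
  simp [segN, List.range_succ]

/-- The right special factors of length `n` of `x`. -/
def rightSpecialFactors (x : ℕ → A) (n : ℕ) : Set (List A) :=
  { w | ∃ i j : ℕ, segN x i n = w ∧ segN x j n = w ∧ x (i + n) ≠ x (j + n) }

lemma segN_eq_wordBefore (x : ℕ → A) (i n : ℕ) :
    segN x i n = wordBefore (fun k : ℤ => x k.toNat) n (i + n) := by
  simp only [segN, wordBefore]
  refine List.map_congr_left fun k _ => ?_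
  congr 1
  omega

lemma rightSpecialFactors_subset (x : ℕ → A) (n : ℕ) : rightSpecialFactors x n ⊆ factors x n :=
  fun _ ⟨i, _, hi, _⟩ => ⟨i, hi⟩

variable [Finite A]

lemma finite_factors (x : ℕ → A) (n : ℕ) : (factors x n).Finite := by
  refine (List.finite_length_eq A n).subset ?_
  rintro _ ⟨e, rfl⟩
  simp [segN]

/-- Extending `x` to the left by a constant adds at most `n` words of length `n`. -/
lemma ncard_range_wordBefore_toNat_le (x : ℕ → A) {n : ℕ} (hn : 1 ≤ n) :
    (Set.range (wordBefore (fun k : ℤ => x k.toNat) n)).ncard ≤ complexityN x n + n := by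
  set y : ℤ → A := fun k : ℤ => x k.toNat with hy
  have hsub : Set.range (wordBefore y n) ⊆
      factors x n ∪ (fun k : ℕ => wordBefore y n k) '' (Finset.range n : Set ℕ) := by
    rintro _ ⟨e, rfl⟩
    rcases le_or_gt (n : ℤ) e with h | h
    · refine Or.inl ⟨(e - n).toNat, ?_⟩
      rw [segN_eq_wordBefore]
      congr 1
      omega
    · refine Or.inr ⟨e.toNat, by simp; omega, ?_⟩
      rw [wordBefore_eq_iff]
      intro k h1 h2
      simp only [hy]
      congr 1
      omega
  refine (Set.ncard_le_ncard hsub ((finite_factors x n).union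
    ((Finset.finite_toSet _).image _))).trans ((Set.ncard_union_le _ _).trans ?_)
  refine Nat.add_le_add_left ((Set.ncard_image_le (Finset.finite_toSet _)).trans ?_) _
  simp

lemma complexityN_succ_le (x : ℕ → A) (n : ℕ) :
    complexityN x (n + 1) ≤
      complexityN x n + (rightSpecialFactors x n).ncard * Nat.card A := by
  have hRS := (finite_factors x n).subset (rightSpecialFactors_subset x n)
  have hex : ∀ w : List A, ∃ i : ℕ, w ∈ factors x n → segN x i n = w := by
    intro w
    by_cases hw : w ∈ factors x n
    · exact ⟨hw.choose, fun _ => hw.choose_spec⟩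
    · exact ⟨0, fun h => absurd h hw⟩
  choose r hr using hex
  have hsub : factors x (n + 1) ⊆ (fun w => w ++ [x (r w + n)]) '' factors x n ∪
      (fun a : List A × A => a.1 ++ [a.2]) '' (rightSpecialFactors x n ×ˢ Set.univ) := by
    rintro _ ⟨i, rfl⟩
    rw [segN_succ]
    have hi : segN x i n ∈ factors x n := ⟨i, rfl⟩
    by_cases h : x (i + n) = x (r (segN x i n) + n)
    · exact Or.inl ⟨_, hi, by rw [h]⟩
    · exact Or.inr ⟨(segN x i n, x (i + n)), ⟨⟨i, _, rfl, hr _ hi, h⟩, trivial⟩, rfl⟩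
  have hfin := hRS.prod (Set.finite_univ (α := A))
  refine (Set.ncard_le_ncard hsub (((finite_factors x n).image _).union (hfin.image _))).trans
    ((Set.ncard_union_le _ _).trans (add_le_add (Set.ncard_image_le (finite_factors x n)) ?_))
  refine (Set.ncard_image_le hfin).trans ?_
  rw [Set.ncard_prod, Set.ncard_univ]

lemma ncard_rightSpecialFactors_le {x : ℕ → A} {C : ℕ}
    (H : ∀ n : ℕ, 1 ≤ n → complexityN x n ≤ C * n) {n : ℕ} (hn : 8 ≤ n) :
    (rightSpecialFactors x n).ncard ≤ (16 * (C + 1) + 1) * (17 * (C + 1)) := by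
  classical
  set y : ℤ → A := fun k : ℤ => x k.toNat with hy
  have HY : ∀ n : ℕ, 1 ≤ n → (Set.range (wordBefore y n)).ncard ≤ (C + 1) * n := by
    intro m hm
    have h1 := ncard_range_wordBefore_toNat_le x hm
    have h2 := H m hm
    calc _ ≤ _ := h1
      _ ≤ _ := by linarith
  have hRS := (finite_factors x n).subset (rightSpecialFactors_subset x n)
  have hex : ∀ w : List A, ∃ e : ℤ, w ∈ rightSpecialFactors x n →
      wordBefore y n e = w ∧ IsSpecialAt y n e := by
    intro w
    by_cases hw : w ∈ rightSpecialFactors x n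
    · obtain ⟨i, j, hi, hj, hij⟩ := hw
      refine ⟨i + n, fun _ => ⟨by rw [← hi, segN_eq_wordBefore], j + n, ?_, ?_⟩⟩
      · rw [← wordBefore_eq_iff, ← segN_eq_wordBefore, ← segN_eq_wordBefore, hi, hj]
      · simpa only [hy, ← Nat.cast_add, Int.toNat_natCast] using hij
    · exact ⟨0, fun h => absurd h hw⟩
  choose e he using hex
  have hinj : Set.InjOn e (rightSpecialFactors x n) := fun w hw w' hw' h => by
    rw [← (he w hw).1, ← (he w' hw').1, h]
  have hmem : ∀ a ∈ hRS.toFinset.image e, ∃ w ∈ rightSpecialFactors x n, e w = a := by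
    simp
  have := card_isSpecialAt_le HY hn (hRS.toFinset.image e)
    (fun a ha => by
      obtain ⟨w, hw, rfl⟩ := hmem a ha
      exact (he w hw).2)
    (fun a ha a' ha' h => by
      obtain ⟨w, hw, rfl⟩ := hmem a ha
      obtain ⟨w', hw', rfl⟩ := hmem a' ha'
      rw [← wordBefore_eq_iff, (he w hw).1, (he w' hw').1] at h
      rw [h])
  rwa [Finset.card_image_of_injOn (by simpa using hinj), ← Set.ncard_eq_toFinset_card _ hRS] at this

end OneSided

/-- **Cassaigne's theorem.**  An infinite sequence `x` over a finite alphabet has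
sub-affine complexity (`p_x(n) ≤ C·n` for all `n ≥ 1`) if and only if the sequence
of first differences `(p_x(n+1) - p_x(n))_{n ≥ 1}` is bounded. -/
theorem cassaigne_subaffine_iff_bounded_differences {A : Type*} [Fintype A]
    (x : ℕ → A) :
    (∃ C : ℕ, ∀ n : ℕ, 1 ≤ n → complexityN x n ≤ C * n) ↔
      (∃ B : ℕ, ∀ n : ℕ, 1 ≤ n → complexityN x (n + 1) - complexityN x n ≤ B) := by
  constructor
  · rintro ⟨C, H⟩
    refine ⟨8 * C + (16 * (C + 1) + 1) * (17 * (C + 1)) * Nat.card A, fun n _ => ?_⟩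
    rcases lt_or_ge n 8 with h8 | h8
    · calc complexityN x (n + 1) - complexityN x n ≤ C * (n + 1) :=
            (Nat.sub_le _ _).trans (H (n + 1) (by omega))
        _ ≤ 8 * C := by nlinarith
        _ ≤ _ := Nat.le_add_right _ _
    · have h1 := complexityN_succ_le x n
      have h2 := Nat.mul_le_mul_right (Nat.card A) (ncard_rightSpecialFactors_le H h8)
      omega
  · rintro ⟨B, H⟩
    refine ⟨complexityN x 1 + B, fun n hn => ?_⟩
    induction n, hn using Nat.le_induction with
    | base => omega
    | succ n hn ih =>
      have := H n hn
      rw [mul_add]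
      omega
end
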